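/- Let N ≥ 1, S = {1,…,N}, let z be an integer with 0 ≤ z ≤ N, let D = {d ∈ {0,1}^N : ∑_i d_i = z}, and let f : {0,1}^N → ℝ. For p ∈ (0,1)^N with weights w_i = p_i/(1−p_i), define Ψ(p) = ∑_{d ∈ D} f(d) · (∏_i w_i^{d_i}) / R(z, S). Then for each i, ∂Ψ/∂p_i = ∑_{d ∈ D} f(d) · ((1+w_i)²/w_i)(d_i − π_i) · (∏_j w_j^{d_j}) / R(z, S), where π_i = w_i R(z−1, S∖{i}) / R(z, S); that is, the gradient of the expected objective equals the expectation, under the conditional Bernoulli PMF, of the objective times the score ∇_p log P(d | z; p). -/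

import Mathlib

open Finset

/-- The R-function: `R(k, A) = ∑_{B ⊆ A, |B| = k} ∏_{i ∈ B} w i`, with
`R(0, A) = 1` and `R(k, A) = 0` for `k < 0` or `k > |A|`. -/
noncomputable def Rfun {ι : Type*} [DecidableEq ι] (w : ι → ℝ) (k : ℤ) (A : Finset ι) : ℝ :=
  if k < 0 then 0 else ∑ B ∈ A.powersetCard k.toNat, ∏ i ∈ B, w i

/-- Bernoulli weights `w_j = p_j / (1 − p_j)`. -/
noncomputable def wOf {N : ℕ} (p : Fin N → ℝ) : Fin N → ℝ := fun j => p j / (1 - p j)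

/-- First-order inclusion probability `π_i = w_i R(z−1, S∖{i}) / R(z, S)`. -/
noncomputable def piOf {N : ℕ} (p : Fin N → ℝ) (z : ℕ) (i : Fin N) : ℝ :=
  wOf p i * Rfun (wOf p) ((z : ℤ) - 1) (Finset.univ.erase i) / Rfun (wOf p) (z : ℤ) Finset.univ

/-- The conditional Bernoulli PMF `P(d | z; p) = (∏_i w_i^{d_i}) / R(z, S)`. -/
noncomputable def cbP {N : ℕ} (p : Fin N → ℝ) (z : ℕ) (d : Fin N → Fin 2) : ℝ :=
  (∏ i, wOf p i ^ (d i : ℕ)) / Rfun (wOf p) (z : ℤ) Finset.univ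

/-- The stochastic objective `Ψ(p) = ∑_{d : ∑ d = z} f(d) P(d | z; p)`. -/
noncomputable def Psi (N : ℕ) (z : ℕ) (f : (Fin N → Fin 2) → ℝ) (q : Fin N → ℝ) : ℝ :=
  ∑ d ∈ Finset.univ.filter (fun d : Fin N → Fin 2 => (∑ i, (d i : ℕ)) = z),
    f d * cbP q z d

theorem Rfun_natCast {ι : Type*} [DecidableEq ι] (w : ι → ℝ) (k : ℕ) (A : Finset ι) :
    Rfun w (k : ℤ) A = ∑ B ∈ A.powersetCard k, ∏ i ∈ B, w i := by
  simp [Rfun]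

theorem Rfun_congr {ι : Type*} [DecidableEq ι] {v w : ι → ℝ} {A : Finset ι}
    (h : ∀ i ∈ A, v i = w i) (k : ℤ) : Rfun v k A = Rfun w k A := by
  unfold Rfun
  split_ifs
  · rfl
  · exact sum_congr rfl fun B hB => prod_congr rfl fun i hi =>
      h i ((mem_powersetCard.1 hB).1 hi)

theorem Rfun_pos {ι : Type*} [DecidableEq ι] {w : ι → ℝ} {A : Finset ι}
    (hw : ∀ i ∈ A, 0 < w i) {k : ℕ} (hk : k ≤ #A) : 0 < Rfun w (k : ℤ) A := by
  rw [Rfun_natCast]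
  exact sum_pos (fun B hB => prod_pos fun i hi => hw i ((mem_powersetCard.1 hB).1 hi))
    (powersetCard_nonempty.2 hk)

theorem Rfun_insert {ι : Type*} [DecidableEq ι] (w : ι → ℝ) (k : ℕ) {A : Finset ι} {i : ι}
    (hi : i ∉ A) :
    Rfun w (k : ℤ) (insert i A) = Rfun w (k : ℤ) A + w i * Rfun w ((k : ℤ) - 1) A := by
  cases k with
  | zero => simp [Rfun]
  | succ n =>
    have hsub : ((n + 1 : ℕ) : ℤ) - 1 = (n : ℤ) := by push_cast; ring
    have hnot : ∀ B ∈ A.powersetCard n, i ∉ B := fun B hB h =>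
      hi ((mem_powersetCard.1 hB).1 h)
    rw [hsub, Rfun_natCast, Rfun_natCast, Rfun_natCast, powersetCard_succ_insert hi,
      sum_union, sum_image, mul_sum]
    · exact congrArg _ (sum_congr rfl fun B hB => prod_insert (hnot B hB))
    · intro B hB C hC h
      rw [← erase_insert (hnot B hB), ← erase_insert (hnot C hC), h]
    · refine disjoint_left.2 fun B hB hB' => ?_
      obtain ⟨C, -, rfl⟩ := mem_image.1 hB'
      exact hi ((mem_powersetCard.1 hB).1 (mem_insert_self i C))

theorem Rfun_update_univ {ι : Type*} [Fintype ι] [DecidableEq ι] (w : ι → ℝ) (k : ℕ) (i : ι)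
    (x : ℝ) :
    Rfun (Function.update w i x) (k : ℤ) univ =
      Rfun w (k : ℤ) (univ.erase i) + x * Rfun w ((k : ℤ) - 1) (univ.erase i) := by
  have h : ∀ j ∈ univ.erase i, Function.update w i x j = w j := fun j hj =>
    Function.update_of_ne (ne_of_mem_erase hj) _ _
  rw [← insert_erase (mem_univ i), Rfun_insert _ _ (notMem_erase i univ), Function.update_self,
    insert_erase (mem_univ i), Rfun_congr h, Rfun_congr h]

theorem wOf_update {N : ℕ} (p : Fin N → ℝ) (i : Fin N) (t : ℝ) :
    wOf (Function.update p i t) = Function.update (wOf p) i (t / (1 - t)) := by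
  ext j
  by_cases h : j = i
  · subst h; simp [wOf]
  · simp [wOf, h]

theorem cbP_update {N : ℕ} (p : Fin N → ℝ) (z : ℕ) (d : Fin N → Fin 2) (i : Fin N) (t : ℝ) :
    cbP (Function.update p i t) z d =
      (t / (1 - t)) ^ (d i : ℕ) * (∏ j ∈ univ.erase i, wOf p j ^ (d j : ℕ)) /
        (Rfun (wOf p) (z : ℤ) (univ.erase i) +
          t / (1 - t) * Rfun (wOf p) ((z : ℤ) - 1) (univ.erase i)) := by
  rw [cbP, wOf_update, Rfun_update_univ, ← mul_prod_erase univ _ (mem_univ i),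
    Function.update_self]
  congr 2
  exact prod_congr rfl fun j hj => by rw [Function.update_of_ne (ne_of_mem_erase hj)]

theorem hasDerivAt_div_one_sub {t : ℝ} (ht : t ≠ 1) :
    HasDerivAt (fun s : ℝ => s / (1 - s)) ((1 + t / (1 - t)) ^ 2) t := by
  have h : 1 - t ≠ 0 := sub_ne_zero.2 ht.symm
  refine ((hasDerivAt_id' t).fun_div ((hasDerivAt_id' t).const_sub 1) h).congr_deriv ?_
  have h1 : 1 + t / (1 - t) = 1 / (1 - t) := by field_simp; ring
  rw [h1, div_pow]
  ring_nf

theorem hasDerivAt_cbP_update {N : ℕ} {z : ℕ} (hz : z ≤ N) {p : Fin N → ℝ}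
    (hp : ∀ i, p i ∈ Set.Ioo (0 : ℝ) 1) (d : Fin N → Fin 2) (i : Fin N) :
    HasDerivAt (fun t : ℝ => cbP (Function.update p i t) z d)
      ((1 + wOf p i) ^ 2 / wOf p i * (((d i : ℕ) : ℝ) - piOf p z i) * cbP p z d) (p i) := by
  have hw : ∀ j, 0 < wOf p j := fun j => div_pos (hp j).1 (sub_pos.2 (hp j).2)
  have hR : Rfun (wOf p) (z : ℤ) univ =
      Rfun (wOf p) (z : ℤ) (univ.erase i) +
        wOf p i * Rfun (wOf p) ((z : ℤ) - 1) (univ.erase i) := by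
    simpa using Rfun_update_univ (wOf p) z i (wOf p i)
  have hR0 : 0 < Rfun (wOf p) (z : ℤ) univ := Rfun_pos (fun j _ => hw j) (by simpa using hz)
  have hP := cbP_update p z d i (p i)
  rw [Function.update_eq_self] at hP
  simp_rw [cbP_update]
  have hx := hasDerivAt_div_one_sub (hp i).2.ne
  rw [hP, piOf, hR]
  rw [hR] at hR0
  have hwi := hw i
  change HasDerivAt _ ((1 + wOf p i) ^ 2) _ at hx
  have hxi : p i / (1 - p i) = wOf p i := rfl
  rw [hxi]
  generalize Rfun (wOf p) (z : ℤ) (univ.erase i) = a at *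
  generalize Rfun (wOf p) ((z : ℤ) - 1) (univ.erase i) = b at *
  generalize ∏ j ∈ univ.erase i, wOf p j ^ (d j : ℕ) = c at *
  refine (((hx.fun_pow (d i : ℕ)).mul_const c).fun_div ((hx.mul_const b).const_add a)
    (by rw [hxi]; exact hR0.ne')).congr_deriv ?_
  simp only [hxi]
  have h2 : (d i : ℕ) = 0 ∨ (d i : ℕ) = 1 := by omega
  rcases h2 with h | h <;> (rw [h]; field_simp; simp; try ring)

/-- the gradient of the expected objective equals the expectation of the
objective times the score:
`∂Ψ/∂p_i = ∑_{d : ∑ d = z} f(d) ((1+w_i)²/w_i)(d_i − π_i) P(d | z; p)`. -/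
theorem stmt_18 (N : ℕ) (hN : 1 ≤ N) (z : ℕ) (hz : z ≤ N)
    (f : (Fin N → Fin 2) → ℝ) (p : Fin N → ℝ) (hp : ∀ i, p i ∈ Set.Ioo (0 : ℝ) 1)
    (i : Fin N) :
    HasDerivAt (fun t : ℝ => Psi N z f (Function.update p i t))
      (∑ d ∈ Finset.univ.filter (fun d : Fin N → Fin 2 => (∑ l, (d l : ℕ)) = z),
        f d * ((1 + wOf p i) ^ 2 / wOf p i * (((d i : ℕ) : ℝ) - piOf p z i)) * cbP p z d)
      (p i) := by
  refine HasDerivAt.fun_sum fun d _ => ?_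
  simpa only [mul_assoc] using (hasDerivAt_cbP_update hz hp d i).const_mul (f d)
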